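/- Let λ, λ', m ∈ ℂ∖{0} with λ, λ' ∉ {1,−1}, and set q = λ², q' = λ'², ℓ = m². Then there exists a unique dual pairing of Hopf algebras ⟨·,·⟩ between U_{q,q'}^{ℓ} (the q-linked quantum enveloping algebra of sl2 ⊕ sl2) and the q-linked quantum group algebra A_{q,q',ℓ}, whose values on generators are: ⟨K,a⟩ = λ, ⟨K,d⟩ = λ⁻¹, ⟨K⁻¹,a⟩ = λ⁻¹, ⟨K⁻¹,d⟩ = λ, ⟨E,b⟩ = 1, ⟨F,c⟩ = 1, ⟨K',a'⟩ = λ'⁻¹, ⟨K',d'⟩ = λ', ⟨K'⁻¹,a'⟩ = λ', ⟨K'⁻¹,d'⟩ = λ'⁻¹, ⟨E',c'⟩ = 1, ⟨F',b'⟩ = 1, ⟨K^{±1},a'⟩ = ⟨K^{±1},d'⟩ = 1, ⟨K'^{±1},a⟩ = ⟨K'^{±1},d⟩ = 1, ⟨L,a⟩ = m, ⟨L,d⟩ = m⁻¹, ⟨L⁻¹,a⟩ = m⁻¹, ⟨L⁻¹,d⟩ = m, ⟨L^{±1},a'⟩ = ⟨L^{±1},d'⟩ = 1, ⟨L',a'⟩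 = m⁻¹, ⟨L',d'⟩ = m, ⟨L'⁻¹,a'⟩ = m, ⟨L'⁻¹,d'⟩ = m⁻¹, ⟨L'^{±1},a⟩ = ⟨L'^{±1},d⟩ = 1, and all other pairings between a generator of U_{q,q'}^{ℓ} and a generator of A_{q,q',ℓ} vanish. Moreover this pairing satisfies ⟨S(x), f⟩ = ⟨x, S(f)⟩ for all x, f. -/

import Mathlib

noncomputable section

open FreeAlgebra
open scoped TensorProduct

/-- The group-like generators of `U_{q,q'}^ℓ`:
`K = 2, K⁻¹ = 3, L = 4, L⁻¹ = 5, K' = 8, K'⁻¹ = 9, L' = 10, L'⁻¹ = 11`. -/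
def glSet : Finset (Fin 12) := {2, 3, 4, 5, 8, 9, 10, 11}

/-- The relations of the q-linked quantum enveloping algebra `U_{q,q'}^ℓ` of
`sl2 ⊕ sl2`, with generators `E = 0, F = 1, K = 2, K⁻¹ = 3, L = 4, L⁻¹ = 5,
E' = 6, F' = 7, K' = 8, K'⁻¹ = 9, L' = 10, L'⁻¹ = 11`. -/
inductive ULinkRel (q q' ℓ : ℂ) :
    FreeAlgebra ℂ (Fin 12) → FreeAlgebra ℂ (Fin 12) → Prop
  | glcomm (i j : Fin 12) (hi : i ∈ glSet) (hj : j ∈ glSet) :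
      ULinkRel q q' ℓ (ι ℂ i * ι ℂ j) (ι ℂ j * ι ℂ i)
  | kki : ULinkRel q q' ℓ (ι ℂ 2 * ι ℂ 3) 1
  | kik : ULinkRel q q' ℓ (ι ℂ 3 * ι ℂ 2) 1
  | lli : ULinkRel q q' ℓ (ι ℂ 4 * ι ℂ 5) 1
  | lil : ULinkRel q q' ℓ (ι ℂ 5 * ι ℂ 4) 1
  | kki' : ULinkRel q q' ℓ (ι ℂ 8 * ι ℂ 9) 1
  | kik' : ULinkRel q q' ℓ (ι ℂ 9 * ι ℂ 8) 1
  | lli' : ULinkRel q q' ℓ (ι ℂ 10 * ι ℂ 11) 1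
  | lil' : ULinkRel q q' ℓ (ι ℂ 11 * ι ℂ 10) 1
  | ke : ULinkRel q q' ℓ (ι ℂ 2 * ι ℂ 0) (q • (ι ℂ 0 * ι ℂ 2))
  | kf : ULinkRel q q' ℓ (ι ℂ 2 * ι ℂ 1) (q⁻¹ • (ι ℂ 1 * ι ℂ 2))
  | le : ULinkRel q q' ℓ (ι ℂ 4 * ι ℂ 0) (ℓ • (ι ℂ 0 * ι ℂ 4))
  | lf : ULinkRel q q' ℓ (ι ℂ 4 * ι ℂ 1) (ℓ⁻¹ • (ι ℂ 1 * ι ℂ 4))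
  | kpep : ULinkRel q q' ℓ (ι ℂ 8 * ι ℂ 6) (q' • (ι ℂ 6 * ι ℂ 8))
  | kpfp : ULinkRel q q' ℓ (ι ℂ 8 * ι ℂ 7) (q'⁻¹ • (ι ℂ 7 * ι ℂ 8))
  | lpep : ULinkRel q q' ℓ (ι ℂ 10 * ι ℂ 6) (ℓ • (ι ℂ 6 * ι ℂ 10))
  | lpfp : ULinkRel q q' ℓ (ι ℂ 10 * ι ℂ 7) (ℓ⁻¹ • (ι ℂ 7 * ι ℂ 10))
  | kpe : ULinkRel q q' ℓ (ι ℂ 8 * ι ℂ 0) (ι ℂ 0 * ι ℂ 8)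
  | kpf : ULinkRel q q' ℓ (ι ℂ 8 * ι ℂ 1) (ι ℂ 1 * ι ℂ 8)
  | lpe : ULinkRel q q' ℓ (ι ℂ 10 * ι ℂ 0) (ι ℂ 0 * ι ℂ 10)
  | lpf : ULinkRel q q' ℓ (ι ℂ 10 * ι ℂ 1) (ι ℂ 1 * ι ℂ 10)
  | kep : ULinkRel q q' ℓ (ι ℂ 2 * ι ℂ 6) (ι ℂ 6 * ι ℂ 2)
  | kfp : ULinkRel q q' ℓ (ι ℂ 2 * ι ℂ 7) (ι ℂ 7 * ι ℂ 2)
  | lep : ULinkRel q q' ℓ (ι ℂ 4 * ι ℂ 6) (ι ℂ 6 * ι ℂ 4)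
  | lfp : ULinkRel q q' ℓ (ι ℂ 4 * ι ℂ 7) (ι ℂ 7 * ι ℂ 4)
  | eep : ULinkRel q q' ℓ (ι ℂ 0 * ι ℂ 6) (ι ℂ 6 * ι ℂ 0)
  | efp : ULinkRel q q' ℓ (ι ℂ 0 * ι ℂ 7) (ι ℂ 7 * ι ℂ 0)
  | fep : ULinkRel q q' ℓ (ι ℂ 1 * ι ℂ 6) (ι ℂ 6 * ι ℂ 1)
  | ffp : ULinkRel q q' ℓ (ι ℂ 1 * ι ℂ 7) (ι ℂ 7 * ι ℂ 1)
  | efrel : ULinkRel q q' ℓ ((q - q⁻¹) • (ι ℂ 0 * ι ℂ 1 - ι ℂ 1 * ι ℂ 0))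
      (ι ℂ 2 * ι ℂ 2 - ι ℂ 3 * ι ℂ 3)
  | efrel' : ULinkRel q q' ℓ ((q' - q'⁻¹) • (ι ℂ 6 * ι ℂ 7 - ι ℂ 7 * ι ℂ 6))
      (ι ℂ 8 * ι ℂ 8 - ι ℂ 9 * ι ℂ 9)

/-- The q-linked quantum enveloping algebra `U_{q,q'}^ℓ`. -/
abbrev ULink (q q' ℓ : ℂ) := RingQuot (ULinkRel q q' ℓ)

/-- The images of the twelve generators of `U_{q,q'}^ℓ`. -/
def ugen (q q' ℓ : ℂ) (i : Fin 12) : ULink q q' ℓ :=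
  RingQuot.mkAlgHom ℂ (ULinkRel q q' ℓ) (ι ℂ i)

/-- The relations of the q-linked quantum group algebra `A_{q,q',ℓ}` with generators
`a, b, c, d` (indices 0–3) and `a', b', c', d'` (indices 4–7). -/
inductive ALinkRel (q q' ℓ : ℂ) :
    FreeAlgebra ℂ (Fin 8) → FreeAlgebra ℂ (Fin 8) → Prop
  | ab : ALinkRel q q' ℓ (ι ℂ 0 * ι ℂ 1) (q⁻¹ • (ι ℂ 1 * ι ℂ 0))
  | ac : ALinkRel q q' ℓ (ι ℂ 0 * ι ℂ 2) (q⁻¹ • (ι ℂ 2 * ι ℂ 0))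
  | bd : ALinkRel q q' ℓ (ι ℂ 1 * ι ℂ 3) (q⁻¹ • (ι ℂ 3 * ι ℂ 1))
  | cd : ALinkRel q q' ℓ (ι ℂ 2 * ι ℂ 3) (q⁻¹ • (ι ℂ 3 * ι ℂ 2))
  | bc : ALinkRel q q' ℓ (ι ℂ 1 * ι ℂ 2) (ι ℂ 2 * ι ℂ 1)
  | ad : ALinkRel q q' ℓ (ι ℂ 0 * ι ℂ 3 - ι ℂ 3 * ι ℂ 0) ((q⁻¹ - q) • (ι ℂ 1 * ι ℂ 2))
  | ab' : ALinkRel q q' ℓ (ι ℂ 4 * ι ℂ 5) (q' • (ι ℂ 5 * ι ℂ 4))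
  | ac' : ALinkRel q q' ℓ (ι ℂ 4 * ι ℂ 6) (q' • (ι ℂ 6 * ι ℂ 4))
  | bd' : ALinkRel q q' ℓ (ι ℂ 5 * ι ℂ 7) (q' • (ι ℂ 7 * ι ℂ 5))
  | cd' : ALinkRel q q' ℓ (ι ℂ 6 * ι ℂ 7) (q' • (ι ℂ 7 * ι ℂ 6))
  | bc' : ALinkRel q q' ℓ (ι ℂ 5 * ι ℂ 6) (ι ℂ 6 * ι ℂ 5)
  | ad' : ALinkRel q q' ℓ (ι ℂ 4 * ι ℂ 7 - ι ℂ 7 * ι ℂ 4) ((q' - q'⁻¹) • (ι ℂ 5 * ι ℂ 6))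
  | link₁ : ALinkRel q q' ℓ (ι ℂ 5 * ι ℂ 0) (ℓ • (ι ℂ 0 * ι ℂ 5))
  | link₂ : ALinkRel q q' ℓ (ι ℂ 0 * ι ℂ 6) (ℓ • (ι ℂ 6 * ι ℂ 0))
  | link₃ : ALinkRel q q' ℓ (ι ℂ 4 * ι ℂ 1) (ℓ • (ι ℂ 1 * ι ℂ 4))
  | link₄ : ALinkRel q q' ℓ (ι ℂ 1 * ι ℂ 7) (ℓ • (ι ℂ 7 * ι ℂ 1))
  | link₅ : ALinkRel q q' ℓ (ι ℂ 2 * ι ℂ 4) (ℓ • (ι ℂ 4 * ι ℂ 2))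
  | link₆ : ALinkRel q q' ℓ (ι ℂ 7 * ι ℂ 2) (ℓ • (ι ℂ 2 * ι ℂ 7))
  | link₇ : ALinkRel q q' ℓ (ι ℂ 3 * ι ℂ 5) (ℓ • (ι ℂ 5 * ι ℂ 3))
  | link₈ : ALinkRel q q' ℓ (ι ℂ 6 * ι ℂ 3) (ℓ • (ι ℂ 3 * ι ℂ 6))
  | comm₁ : ALinkRel q q' ℓ (ι ℂ 0 * ι ℂ 4) (ι ℂ 4 * ι ℂ 0)
  | comm₂ : ALinkRel q q' ℓ (ι ℂ 0 * ι ℂ 7) (ι ℂ 7 * ι ℂ 0)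
  | comm₃ : ALinkRel q q' ℓ (ι ℂ 1 * ι ℂ 5) (ι ℂ 5 * ι ℂ 1)
  | comm₄ : ALinkRel q q' ℓ (ι ℂ 1 * ι ℂ 6) (ι ℂ 6 * ι ℂ 1)
  | comm₅ : ALinkRel q q' ℓ (ι ℂ 2 * ι ℂ 5) (ι ℂ 5 * ι ℂ 2)
  | comm₆ : ALinkRel q q' ℓ (ι ℂ 2 * ι ℂ 6) (ι ℂ 6 * ι ℂ 2)
  | comm₇ : ALinkRel q q' ℓ (ι ℂ 3 * ι ℂ 4) (ι ℂ 4 * ι ℂ 3)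
  | comm₈ : ALinkRel q q' ℓ (ι ℂ 3 * ι ℂ 7) (ι ℂ 7 * ι ℂ 3)
  | det : ALinkRel q q' ℓ (ι ℂ 0 * ι ℂ 3 - q⁻¹ • (ι ℂ 1 * ι ℂ 2)) 1
  | det' : ALinkRel q q' ℓ (ι ℂ 4 * ι ℂ 7 - q' • (ι ℂ 5 * ι ℂ 6)) 1

/-- The q-linked quantum group algebra `A_{q,q',ℓ}`. -/
abbrev ALink (q q' ℓ : ℂ) := RingQuot (ALinkRel q q' ℓ)

/-- The images of the eight generators of `A_{q,q',ℓ}`. -/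
def agen (q q' ℓ : ℂ) (i : Fin 8) : ALink q q' ℓ :=
  RingQuot.mkAlgHom ℂ (ALinkRel q q' ℓ) (ι ℂ i)

/-- The pairing on tensor squares induced by a bilinear pairing `B`:
`(x ⊗ y, f ⊗ g) ↦ B x f · B y g`. -/
def pair2 {H A : Type*} [AddCommGroup H] [Module ℂ H] [AddCommGroup A] [Module ℂ A]
    (B : H →ₗ[ℂ] Module.Dual ℂ A) :
    (H ⊗[ℂ] H) →ₗ[ℂ] Module.Dual ℂ (A ⊗[ℂ] A) :=
  (TensorProduct.dualDistrib ℂ A A).comp (TensorProduct.map B B)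

/-- `B` is a dual pairing of the Hopf algebras `H` (with comultiplication `ΔH` and
counit `εH`) and `A` (with comultiplication `ΔA` and counit `εA`):
`⟨xy, f⟩ = Σ⟨x, f₍₁₎⟩⟨y, f₍₂₎⟩`, `⟨x, fg⟩ = Σ⟨x₍₁₎, f⟩⟨x₍₂₎, g⟩`, `⟨1, f⟩ = εA f`,
`⟨x, 1⟩ = εH x`. -/
def IsDualPairing {H A : Type*} [Ring H] [Algebra ℂ H] [Ring A] [Algebra ℂ A]
    (B : H →ₗ[ℂ] Module.Dual ℂ A)
    (ΔH : H →ₐ[ℂ] (H ⊗[ℂ] H)) (εH : H →ₐ[ℂ] ℂ)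
    (ΔA : A →ₐ[ℂ] (A ⊗[ℂ] A)) (εA : A →ₐ[ℂ] ℂ) : Prop :=
  (∀ (x y : H) (f : A), B (x * y) f = pair2 B (x ⊗ₜ[ℂ] y) (ΔA f)) ∧
  (∀ (x : H) (f g : A), B x (f * g) = pair2 B (ΔH x) (f ⊗ₜ[ℂ] g)) ∧
  (∀ f : A, B 1 f = εA f) ∧
  (∀ x : H, B x 1 = εH x)

/-- `ΔH` is the comultiplication of `U_{q,q'}^ℓ`:
`Δ(E) = E⊗KL' + K⁻¹L'⁻¹⊗E`, `Δ(F) = F⊗KL'⁻¹ + K⁻¹L'⊗F`,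
`Δ(E') = E'⊗K'L⁻¹ + K'⁻¹L⊗E'`, `Δ(F') = F'⊗K'L + K'⁻¹L⁻¹⊗F'`, and the
generators `K^{±1}, L^{±1}, K'^{±1}, L'^{±1}` are group-like. -/
def IsUComul (q q' ℓ : ℂ)
    (ΔH : ULink q q' ℓ →ₐ[ℂ] (ULink q q' ℓ ⊗[ℂ] ULink q q' ℓ)) : Prop :=
  let u := ugen q q' ℓ
  ΔH (u 0) = u 0 ⊗ₜ[ℂ] (u 2 * u 10) + (u 3 * u 11) ⊗ₜ[ℂ] u 0 ∧
  ΔH (u 1) = u 1 ⊗ₜ[ℂ] (u 2 * u 11) + (u 3 * u 10) ⊗ₜ[ℂ] u 1 ∧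
  ΔH (u 6) = u 6 ⊗ₜ[ℂ] (u 8 * u 5) + (u 9 * u 4) ⊗ₜ[ℂ] u 6 ∧
  ΔH (u 7) = u 7 ⊗ₜ[ℂ] (u 8 * u 4) + (u 9 * u 5) ⊗ₜ[ℂ] u 7 ∧
  (∀ i ∈ glSet, ΔH (u i) = u i ⊗ₜ[ℂ] u i)

/-- `εH` is the counit of `U_{q,q'}^ℓ`: it vanishes on `E, F, E', F'` and equals `1`
on the group-like generators. -/
def IsUCounit (q q' ℓ : ℂ) (εH : ULink q q' ℓ →ₐ[ℂ] ℂ) : Prop :=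
  let u := ugen q q' ℓ
  εH (u 0) = 0 ∧ εH (u 1) = 0 ∧ εH (u 6) = 0 ∧ εH (u 7) = 0 ∧
  (∀ i ∈ glSet, εH (u i) = 1)

/-- `SH` is the antipode of `U_{q,q'}^ℓ`: a linear algebra antihomomorphism with
`S(E) = −qE`, `S(F) = −q⁻¹F`, `S(E') = −q'E'`, `S(F') = −q'⁻¹F'`, inverting the
group-like generators. -/
def IsUAntipode (q q' ℓ : ℂ) (SH : ULink q q' ℓ →ₗ[ℂ] ULink q q' ℓ) : Prop :=
  let u := ugen q q' ℓ
  (∀ x y : ULink q q' ℓ, SH (x * y) = SH y * SH x) ∧ SH 1 = 1 ∧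
  SH (u 0) = (-q) • u 0 ∧ SH (u 1) = (-q⁻¹) • u 1 ∧
  SH (u 6) = (-q') • u 6 ∧ SH (u 7) = (-q'⁻¹) • u 7 ∧
  SH (u 2) = u 3 ∧ SH (u 3) = u 2 ∧ SH (u 4) = u 5 ∧ SH (u 5) = u 4 ∧
  SH (u 8) = u 9 ∧ SH (u 9) = u 8 ∧ SH (u 10) = u 11 ∧ SH (u 11) = u 10

/-- `ΔA` is the matrix comultiplication on both sectors of `A_{q,q',ℓ}`. -/
def IsAComul (q q' ℓ : ℂ)
    (ΔA : ALink q q' ℓ →ₐ[ℂ] (ALink q q' ℓ ⊗[ℂ] ALink q q' ℓ)) : Prop :=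
  let a := agen q q' ℓ
  ΔA (a 0) = a 0 ⊗ₜ[ℂ] a 0 + a 1 ⊗ₜ[ℂ] a 2 ∧
  ΔA (a 1) = a 0 ⊗ₜ[ℂ] a 1 + a 1 ⊗ₜ[ℂ] a 3 ∧
  ΔA (a 2) = a 2 ⊗ₜ[ℂ] a 0 + a 3 ⊗ₜ[ℂ] a 2 ∧
  ΔA (a 3) = a 2 ⊗ₜ[ℂ] a 1 + a 3 ⊗ₜ[ℂ] a 3 ∧
  ΔA (a 4) = a 4 ⊗ₜ[ℂ] a 4 + a 5 ⊗ₜ[ℂ] a 6 ∧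
  ΔA (a 5) = a 4 ⊗ₜ[ℂ] a 5 + a 5 ⊗ₜ[ℂ] a 7 ∧
  ΔA (a 6) = a 6 ⊗ₜ[ℂ] a 4 + a 7 ⊗ₜ[ℂ] a 6 ∧
  ΔA (a 7) = a 6 ⊗ₜ[ℂ] a 5 + a 7 ⊗ₜ[ℂ] a 7

/-- `εA` is the counit of `A_{q,q',ℓ}`, sending both matrices of generators to the
identity matrix. -/
def IsACounit (q q' ℓ : ℂ) (εA : ALink q q' ℓ →ₐ[ℂ] ℂ) : Prop :=
  let a := agen q q' ℓ
  εA (a 0) = 1 ∧ εA (a 1) = 0 ∧ εA (a 2) = 0 ∧ εA (a 3) = 1 ∧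
  εA (a 4) = 1 ∧ εA (a 5) = 0 ∧ εA (a 6) = 0 ∧ εA (a 7) = 1

/-- `SA` is the antipode of `A_{q,q',ℓ}`: a linear algebra antihomomorphism with
`S(a) = d`, `S(b) = −qb`, `S(c) = −q⁻¹c`, `S(d) = a`, `S(a') = d'`,
`S(b') = −q'⁻¹b'`, `S(c') = −q'c'`, `S(d') = a'`. -/
def IsAAntipode (q q' ℓ : ℂ) (SA : ALink q q' ℓ →ₗ[ℂ] ALink q q' ℓ) : Prop :=
  let a := agen q q' ℓ
  (∀ x y : ALink q q' ℓ, SA (x * y) = SA y * SA x) ∧ SA 1 = 1 ∧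
  SA (a 0) = a 3 ∧ SA (a 1) = (-q) • a 1 ∧ SA (a 2) = (-q⁻¹) • a 2 ∧
  SA (a 3) = a 0 ∧ SA (a 4) = a 7 ∧ SA (a 5) = (-q'⁻¹) • a 5 ∧
  SA (a 6) = (-q') • a 6 ∧ SA (a 7) = a 4

/-- The table of values of the dual pairing on the generators: rows are the twelve
generators `E, F, K, K⁻¹, L, L⁻¹, E', F', K', K'⁻¹, L', L'⁻¹` of `U_{q,q'}^ℓ`,
columns the eight generators `a, b, c, d, a', b', c', d'` of `A_{q,q',ℓ}`,
with `q = λ²`, `q' = λ'²`, `ℓ = m²`; all pairings not listed in the statement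
vanish. -/
def pv (l l' m : ℂ) : Fin 12 → Fin 8 → ℂ :=
  ![![0, 1, 0, 0, 0, 0, 0, 0],
    ![0, 0, 1, 0, 0, 0, 0, 0],
    ![l, 0, 0, l⁻¹, 1, 0, 0, 1],
    ![l⁻¹, 0, 0, l, 1, 0, 0, 1],
    ![m, 0, 0, m⁻¹, 1, 0, 0, 1],
    ![m⁻¹, 0, 0, m, 1, 0, 0, 1],
    ![0, 0, 0, 0, 0, 0, 1, 0],
    ![0, 0, 0, 0, 0, 1, 0, 0],
    ![1, 0, 0, 1, l'⁻¹, 0, 0, l'],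
    ![1, 0, 0, 1, l', 0, 0, l'⁻¹],
    ![1, 0, 0, 1, m⁻¹, 0, 0, m],
    ![1, 0, 0, 1, m, 0, 0, m⁻¹]]

theorem ULink.induction {q q' ℓ : ℂ} {P : ULink q q' ℓ → Prop}
    (algebraMap : ∀ r : ℂ, P (algebraMap ℂ _ r)) (gen : ∀ i, P (ugen q q' ℓ i))
    (mul : ∀ x y, P x → P y → P (x * y)) (add : ∀ x y, P x → P y → P (x + y))
    (x : ULink q q' ℓ) : P x := by
  obtain ⟨y, rfl⟩ := RingQuot.mkAlgHom_surjective ℂ (ULinkRel q q' ℓ) x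
  induction y using FreeAlgebra.induction with
  | grade0 r => simpa using algebraMap r
  | grade1 i => exact gen i
  | mul a b ha hb => simpa using mul _ _ ha hb
  | add a b ha hb => simpa using add _ _ ha hb

theorem ALink.induction {q q' ℓ : ℂ} {P : ALink q q' ℓ → Prop}
    (algebraMap : ∀ r : ℂ, P (algebraMap ℂ _ r)) (gen : ∀ i, P (agen q q' ℓ i))
    (mul : ∀ x y, P x → P y → P (x * y)) (add : ∀ x y, P x → P y → P (x + y))
    (x : ALink q q' ℓ) : P x := by
  obtain ⟨y, rfl⟩ := RingQuot.mkAlgHom_surjective ℂ (ALinkRel q q' ℓ) x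
  induction y using FreeAlgebra.induction with
  | grade0 r => simpa using algebraMap r
  | grade1 i => exact gen i
  | mul a b ha hb => simpa using mul _ _ ha hb
  | add a b ha hb => simpa using add _ _ ha hb

theorem ULink.algHom_ext {q q' ℓ : ℂ} {B : Type*} [Semiring B] [Algebra ℂ B]
    {f g : ULink q q' ℓ →ₐ[ℂ] B} (h : ∀ i, f (ugen q q' ℓ i) = g (ugen q q' ℓ i)) : f = g := by
  ext i
  exact h i

theorem ugen_commute {q q' ℓ : ℂ} {i j : Fin 12} (hi : i ∈ glSet) (hj : j ∈ glSet) :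
    ugen q q' ℓ i * ugen q q' ℓ j = ugen q q' ℓ j * ugen q q' ℓ i := by
  simpa only [map_mul, ugen] using RingQuot.mkAlgHom_rel ℂ (ULinkRel.glcomm (q := q) (q' := q')
    (ℓ := ℓ) i j hi hj)

/-- Every generator of `U_{q,q'}^ℓ` is group-like or one of `E, F, E', F'`. -/
theorem forall_ugen_index {P : Fin 12 → Prop} (h0 : P 0) (h1 : P 1) (h6 : P 6) (h7 : P 7)
    (hg : ∀ i ∈ glSet, P i) (i : Fin 12) : P i := by
  by_cases hi : i ∈ glSet
  · exact hg i hi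
  · revert hi
    fin_cases i <;> simp [glSet] <;> assumption

/-- The comultiplication and counit of `U_{q,q'}^ℓ` make it a coalgebra. -/
abbrev ulinkCoalgebra {q q' ℓ : ℂ} (ΔH : ULink q q' ℓ →ₐ[ℂ] (ULink q q' ℓ ⊗[ℂ] ULink q q' ℓ))
    (εH : ULink q q' ℓ →ₐ[ℂ] ℂ) (hΔ : IsUComul q q' ℓ ΔH) (hε : IsUCounit q q' ℓ εH) :
    Coalgebra ℂ (ULink q q' ℓ) :=
  (Bialgebra.ofAlgHom ΔH εH
    (by
      obtain ⟨h0, h1, h6, h7, hg⟩ := hΔ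
      simp only [glSet, Finset.mem_insert, Finset.mem_singleton, forall_eq_or_imp,
        forall_eq] at hg
      obtain ⟨h2, h3, h4, h5, h8, h9, h10, h11⟩ := hg
      refine ULink.algHom_ext fun i => ?_
      fin_cases i <;>
        simp [h0, h1, h2, h3, h4, h5, h6, h7, h8, h9, h10, h11, TensorProduct.tmul_add,
          TensorProduct.add_tmul, Algebra.TensorProduct.tmul_mul_tmul, add_assoc])
    (by
      obtain ⟨h0, h1, h6, h7, hg⟩ := hΔ
      obtain ⟨e0, e1, e6, e7, eg⟩ := hε
      refine ULink.algHom_ext fun i => ?_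
      revert i
      refine forall_ugen_index ?_ ?_ ?_ ?_ fun i hi => by simp [hg i hi, eg i hi]
      · simp [h0, e0, eg 3 (by decide), eg 11 (by decide)]
      · simp [h1, e1, eg 3 (by decide), eg 10 (by decide)]
      · simp [h6, e6, eg 9 (by decide), eg 4 (by decide)]
      · simp [h7, e7, eg 9 (by decide), eg 5 (by decide)])
    (by
      obtain ⟨h0, h1, h6, h7, hg⟩ := hΔ
      obtain ⟨e0, e1, e6, e7, eg⟩ := hε
      refine ULink.algHom_ext fun i => ?_
      revert i
      refine forall_ugen_index ?_ ?_ ?_ ?_ fun i hi => by simp [hg i hi, eg i hi]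
      · simp [h0, e0, eg 2 (by decide), eg 10 (by decide)]
      · simp [h1, e1, eg 2 (by decide), eg 11 (by decide)]
      · simp [h6, e6, eg 8 (by decide), eg 5 (by decide)]
      · simp [h7, e7, eg 8 (by decide), eg 4 (by decide)])).toCoalgebra

/-- The position in the list of generators of `A_{q,q',ℓ}` of the entry `(i, j)` of the first
(`s = 0`) or second (`s = 1`) matrix of generators. -/
def matIdx (s i j : Fin 2) : Fin 8 := ![![![0, 1], ![2, 3]], ![![4, 5], ![6, 7]]] s i j

/-- The two fundamental representations of `U_{q,q'}^ℓ`, on generators. -/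
def genMatrix (l l' m : ℂ) (s : Fin 2) (n : Fin 12) : Matrix (Fin 2) (Fin 2) ℂ :=
  Matrix.of fun i j => pv l l' m n (matIdx s i j)

theorem genMatrix_zero (l l' m : ℂ) : genMatrix l l' m 0 =
    ![!![0, 1; 0, 0], !![0, 0; 1, 0], !![l, 0; 0, l⁻¹], !![l⁻¹, 0; 0, l], !![m, 0; 0, m⁻¹],
      !![m⁻¹, 0; 0, m], 0, 0, 1, 1, 1, 1] := by
  funext n
  ext i j
  fin_cases n <;> fin_cases i <;> fin_cases j <;> rfl

theorem genMatrix_one (l l' m : ℂ) : genMatrix l l' m 1 =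
    ![0, 0, 1, 1, 1, 1, !![0, 0; 1, 0], !![0, 1; 0, 0], !![l'⁻¹, 0; 0, l'],
      !![l', 0; 0, l'⁻¹], !![m⁻¹, 0; 0, m], !![m, 0; 0, m⁻¹]] := by
  funext n
  ext i j
  fin_cases n <;> fin_cases i <;> fin_cases j <;> rfl

theorem genMatrix_apply_eq_zero (l l' m : ℂ) (s : Fin 2) {n : Fin 12} (hn : n ∈ glSet)
    {i j : Fin 2} (hij : i ≠ j) : genMatrix l l' m s n i j = 0 := by
  revert hij hn
  fin_cases s <;> fin_cases i <;> fin_cases j <;> fin_cases n <;>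
    simp [glSet, genMatrix, matIdx, pv]

theorem genMatrix_rel {l l' m : ℂ} (hl : l ≠ 0) (hl' : l' ≠ 0) (hm : m ≠ 0) (s : Fin 2)
    ⦃x y : FreeAlgebra ℂ (Fin 12)⦄ (h : ULinkRel (l ^ 2) (l' ^ 2) (m ^ 2) x y) :
    FreeAlgebra.lift ℂ (genMatrix l l' m s) x = FreeAlgebra.lift ℂ (genMatrix l l' m s) y := by
  cases h with
  | glcomm i j hi hj =>
    ext a b
    have h1 := fun a b h => genMatrix_apply_eq_zero l l' m s hi (i := a) (j := b) h
    have h2 := fun a b h => genMatrix_apply_eq_zero l l' m s hj (i := a) (j := b) h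
    fin_cases a <;> fin_cases b <;>
      simp [Matrix.mul_apply, h1 0 1, h1 1 0, h2 0 1, h2 1 0, mul_comm]
  | _ =>
    all_goals
      ext a b
      fin_cases s <;> fin_cases a <;> fin_cases b <;>
        simp [genMatrix_zero, genMatrix_one, Matrix.mul_apply, Matrix.one_apply] <;> field_simp

/-- The fundamental representations of `U_{q,q'}^ℓ`: on the first (`s = 0`) or second (`s = 1`)
copy of `ℂ²`. -/
def fundRep {l l' m : ℂ} (hl : l ≠ 0) (hl' : l' ≠ 0) (hm : m ≠ 0) (s : Fin 2) :
    ULink (l ^ 2) (l' ^ 2) (m ^ 2) →ₐ[ℂ] Matrix (Fin 2) (Fin 2) ℂ :=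
  RingQuot.liftAlgHom ℂ ⟨FreeAlgebra.lift ℂ (genMatrix l l' m s), genMatrix_rel hl hl' hm s⟩

@[simp]
theorem fundRep_ugen {l l' m : ℂ} (hl : l ≠ 0) (hl' : l' ≠ 0) (hm : m ≠ 0) (s : Fin 2)
    (n : Fin 12) : fundRep hl hl' hm s (ugen _ _ _ n) = genMatrix l l' m s n := by
  simp [fundRep, ugen]

section kronRep

variable {H n : Type*} [Ring H] [Algebra ℂ H] [Fintype n] [DecidableEq n]

/-- The linear functional `x ↦ ρ(x)ᵢⱼ` attached to a matrix representation `ρ`. -/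
def coeffFun (ρ : H →ₐ[ℂ] Matrix n n ℂ) (i j : n) : H →ₗ[ℂ] ℂ :=
  Matrix.entryLinearMap ℂ ℂ i j ∘ₗ ρ.toLinearMap

@[simp]
theorem coeffFun_apply (ρ : H →ₐ[ℂ] Matrix n n ℂ) (i j : n) (x : H) :
    coeffFun ρ i j x = ρ x i j := rfl

/-- The tensor product of two matrix representations of an algebra with comultiplication `Δ`. -/
def kronRep (Δ : H →ₐ[ℂ] H ⊗[ℂ] H) (ρ σ : H →ₐ[ℂ] Matrix n n ℂ) :
    H →ₐ[ℂ] Matrix (n × n) (n × n) ℂ :=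
  ((Algebra.TensorProduct.lmul' ℂ (S := ℂ)).mapMatrix.comp
    (Matrix.kroneckerTMulAlgEquiv n n ℂ ℂ ℂ ℂ).toAlgHom).comp
      ((Algebra.TensorProduct.map ρ σ).comp Δ)

theorem kronRep_apply (Δ : H →ₐ[ℂ] H ⊗[ℂ] H) (ρ σ : H →ₐ[ℂ] Matrix n n ℂ) (x : H)
    (i j k o : n) :
    kronRep Δ ρ σ x (i, j) (k, o) =
      LinearMap.mul' ℂ ℂ (TensorProduct.map (coeffFun ρ i k) (coeffFun σ j o) (Δ x)) := by
  simp only [kronRep, AlgHom.comp_apply]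
  induction Δ x using TensorProduct.induction_on with
  | zero => simp
  | tmul a b => simp
  | add a b ha hb => simpa [mul_add, add_mul] using congrArg₂ (· + ·) ha hb

open scoped Kronecker

theorem kronRep_eq_of_comul {Δ : H →ₐ[ℂ] H ⊗[ℂ] H} (ρ σ : H →ₐ[ℂ] Matrix n n ℂ) {x a b : H}
    (h : Δ x = a ⊗ₜ b) : kronRep Δ ρ σ x = ρ a ⊗ₖ σ b := by
  ext ⟨i, j⟩ ⟨k, o⟩
  simp [kronRep_apply, h]

theorem kronRep_eq_of_comul_add {Δ : H →ₐ[ℂ] H ⊗[ℂ] H} (ρ σ : H →ₐ[ℂ] Matrix n n ℂ)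
    {x a b c d : H} (h : Δ x = a ⊗ₜ b + c ⊗ₜ d) :
    kronRep Δ ρ σ x = ρ a ⊗ₖ σ b + ρ c ⊗ₖ σ d := by
  ext ⟨i, j⟩ ⟨k, o⟩
  simp [kronRep_apply, h]

end kronRep

section relations

open scoped Kronecker

variable {l l' m : ℂ}

/-- The action of the generators on tensor products of fundamental representations. -/
def genKron (l l' m : ℂ) (s t : Fin 2) (n : Fin 12) :
    Matrix (Fin 2 × Fin 2) (Fin 2 × Fin 2) ℂ :=
  let g := genMatrix l l' m s
  let h := genMatrix l l' m t
  ![g 0 ⊗ₖ (h 2 * h 10) + (g 3 * g 11) ⊗ₖ h 0, g 1 ⊗ₖ (h 2 * h 11) + (g 3 * g 10) ⊗ₖ h 1,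
    g 2 ⊗ₖ h 2, g 3 ⊗ₖ h 3, g 4 ⊗ₖ h 4, g 5 ⊗ₖ h 5,
    g 6 ⊗ₖ (h 8 * h 5) + (g 9 * g 4) ⊗ₖ h 6, g 7 ⊗ₖ (h 8 * h 4) + (g 9 * g 5) ⊗ₖ h 7,
    g 8 ⊗ₖ h 8, g 9 ⊗ₖ h 9, g 10 ⊗ₖ h 10, g 11 ⊗ₖ h 11] n

theorem kronRep_ugen (hl : l ≠ 0) (hl' : l' ≠ 0) (hm : m ≠ 0)
    {ΔH : ULink (l ^ 2) (l' ^ 2) (m ^ 2) →ₐ[ℂ]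
      (ULink (l ^ 2) (l' ^ 2) (m ^ 2) ⊗[ℂ] ULink (l ^ 2) (l' ^ 2) (m ^ 2))}
    (hΔ : IsUComul (l ^ 2) (l' ^ 2) (m ^ 2) ΔH) (s t : Fin 2)
    (n : Fin 12) :
    kronRep ΔH (fundRep hl hl' hm s) (fundRep hl hl' hm t) (ugen _ _ _ n) =
      genKron l l' m s t n := by
  obtain ⟨h0, h1, h6, h7, hg⟩ := hΔ
  revert n
  refine forall_ugen_index ?_ ?_ ?_ ?_ fun n hn => ?_
  · simp [kronRep_eq_of_comul_add _ _ h0, genKron]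
  · simp [kronRep_eq_of_comul_add _ _ h1, genKron]
  · simp [kronRep_eq_of_comul_add _ _ h6, genKron]
  · simp [kronRep_eq_of_comul_add _ _ h7, genKron]
  · rw [kronRep_eq_of_comul _ _ (hg n hn), fundRep_ugen, fundRep_ugen]
    revert hn
    fin_cases n <;> simp [glSet, genKron]

/-- The invariant vector of the tensor square of a fundamental representation. -/
def invVec (l l' : ℂ) (s : Fin 2) (p : Fin 2 × Fin 2) : ℂ :=
  !![0, 1; -![(l ^ 2)⁻¹, l' ^ 2] s, 0] p.1 p.2

/-- The counit of `U_{q,q'}^ℓ` on generators. -/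
def genCounit : Fin 12 → ℂ := ![0, 0, 1, 1, 1, 1, 0, 0, 1, 1, 1, 1]

theorem counit_ugen {q q' ℓ : ℂ} {ε : ULink q q' ℓ →ₐ[ℂ] ℂ} (hε : IsUCounit q q' ℓ ε)
    (n : Fin 12) : ε (ugen _ _ _ n) = genCounit n := by
  obtain ⟨h0, h1, h6, h7, hg⟩ := hε
  revert n
  refine forall_ugen_index (by simp [h0, genCounit]) (by simp [h1, genCounit])
    (by simp [h6, genCounit]) (by simp [h7, genCounit]) fun n hn => ?_
  rw [hg n hn]
  revert hn
  fin_cases n <;> simp [glSet, genCounit]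

theorem genKron_mulVec_invVec (hl : l ≠ 0) (hl' : l' ≠ 0) (hm : m ≠ 0) (s : Fin 2) (n : Fin 12) :
    (genKron l l' m s s n).mulVec (invVec l l' s) = genCounit n • invVec l l' s := by
  ext ⟨i, j⟩
  fin_cases s <;> fin_cases n <;> fin_cases i <;> fin_cases j <;>
    simp [genKron, genMatrix_zero, genMatrix_one, invVec, genCounit, Matrix.mulVec, dotProduct,
      Fintype.sum_prod_type, Matrix.kroneckerMap_apply, Matrix.one_apply] <;>
    field_simp <;> ring

theorem invVec_vecMul_genKron (hl : l ≠ 0) (hl' : l' ≠ 0) (hm : m ≠ 0) (s : Fin 2) (n : Fin 12) :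
    Matrix.vecMul (invVec l l' s) (genKron l l' m s s n) = genCounit n • invVec l l' s := by
  ext ⟨i, j⟩
  fin_cases s <;> fin_cases n <;> fin_cases i <;> fin_cases j <;>
    simp [genKron, genMatrix_zero, genMatrix_one, invVec, genCounit, Matrix.vecMul, dotProduct,
      Fintype.sum_prod_type, Matrix.kroneckerMap_apply, Matrix.one_apply] <;>
    field_simp <;> ring

/-- The coefficients of the linking braiding between the two fundamental representations. -/
def linkCoeff (ℓ : ℂ) (p : Fin 2 × Fin 2) : ℂ := if p.1 = p.2 then 1 else ℓ

set_option maxHeartbeats 1000000 in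
theorem genKron_link (hl : l ≠ 0) (hl' : l' ≠ 0) (hm : m ≠ 0) (n : Fin 12) :
    genKron l l' m 0 1 n * Matrix.diagonal (linkCoeff (m ^ 2)) =
      Matrix.diagonal (linkCoeff (m ^ 2)) *
        (genKron l l' m 1 0 n).submatrix (Equiv.prodComm _ _) (Equiv.prodComm _ _) := by
  ext ⟨i, j⟩ ⟨k, o⟩
  rw [Matrix.mul_diagonal, Matrix.diagonal_mul, Matrix.submatrix_apply]
  fin_cases n <;> fin_cases i <;> fin_cases j <;> fin_cases k <;> fin_cases o <;>
    simp [genKron, genMatrix_zero, genMatrix_one, linkCoeff, Matrix.kroneckerMap_apply] <;>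
    field_simp

theorem kronRep_mulVec_invVec (hl : l ≠ 0) (hl' : l' ≠ 0) (hm : m ≠ 0)
    {ΔH : ULink (l ^ 2) (l' ^ 2) (m ^ 2) →ₐ[ℂ]
      (ULink (l ^ 2) (l' ^ 2) (m ^ 2) ⊗[ℂ] ULink (l ^ 2) (l' ^ 2) (m ^ 2))}
    (hΔ : IsUComul (l ^ 2) (l' ^ 2) (m ^ 2) ΔH)
    {εH : ULink (l ^ 2) (l' ^ 2) (m ^ 2) →ₐ[ℂ] ℂ} (hε : IsUCounit (l ^ 2) (l' ^ 2) (m ^ 2) εH)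
    (s : Fin 2) (x : ULink (l ^ 2) (l' ^ 2) (m ^ 2)) :
    (kronRep ΔH (fundRep hl hl' hm s) (fundRep hl hl' hm s) x).mulVec (invVec l l' s) =
      εH x • invVec l l' s := by
  induction x using ULink.induction with
  | algebraMap r => simp [Algebra.algebraMap_eq_smul_one, Matrix.smul_mulVec]
  | gen n => rw [kronRep_ugen _ _ _ hΔ, counit_ugen hε, genKron_mulVec_invVec hl hl' hm]
  | mul x y hx hy =>
    rw [map_mul, map_mul, ← Matrix.mulVec_mulVec, hy, Matrix.mulVec_smul, hx, smul_smul, mul_comm]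
  | add x y hx hy => rw [map_add, map_add, Matrix.add_mulVec, hx, hy, add_smul]

theorem invVec_vecMul_kronRep (hl : l ≠ 0) (hl' : l' ≠ 0) (hm : m ≠ 0)
    {ΔH : ULink (l ^ 2) (l' ^ 2) (m ^ 2) →ₐ[ℂ]
      (ULink (l ^ 2) (l' ^ 2) (m ^ 2) ⊗[ℂ] ULink (l ^ 2) (l' ^ 2) (m ^ 2))}
    (hΔ : IsUComul (l ^ 2) (l' ^ 2) (m ^ 2) ΔH)
    {εH : ULink (l ^ 2) (l' ^ 2) (m ^ 2) →ₐ[ℂ] ℂ} (hε : IsUCounit (l ^ 2) (l' ^ 2) (m ^ 2) εH)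
    (s : Fin 2) (x : ULink (l ^ 2) (l' ^ 2) (m ^ 2)) :
    Matrix.vecMul (invVec l l' s) (kronRep ΔH (fundRep hl hl' hm s) (fundRep hl hl' hm s) x) =
      εH x • invVec l l' s := by
  induction x using ULink.induction with
  | algebraMap r => simp [Algebra.algebraMap_eq_smul_one, Matrix.vecMul_smul]
  | gen n => rw [kronRep_ugen _ _ _ hΔ, counit_ugen hε, invVec_vecMul_genKron hl hl' hm]
  | mul x y hx hy =>
    rw [map_mul, map_mul, ← Matrix.vecMul_vecMul, hx, Matrix.smul_vecMul, hy, smul_smul]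
  | add x y hx hy => rw [map_add, map_add, Matrix.vecMul_add, hx, hy, add_smul]

theorem kronRep_link (hl : l ≠ 0) (hl' : l' ≠ 0) (hm : m ≠ 0)
    {ΔH : ULink (l ^ 2) (l' ^ 2) (m ^ 2) →ₐ[ℂ]
      (ULink (l ^ 2) (l' ^ 2) (m ^ 2) ⊗[ℂ] ULink (l ^ 2) (l' ^ 2) (m ^ 2))}
    (hΔ : IsUComul (l ^ 2) (l' ^ 2) (m ^ 2) ΔH)
    (x : ULink (l ^ 2) (l' ^ 2) (m ^ 2)) :
    kronRep ΔH (fundRep hl hl' hm 0) (fundRep hl hl' hm 1) x * Matrix.diagonal (linkCoeff (m ^ 2)) =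
      Matrix.diagonal (linkCoeff (m ^ 2)) *
        (kronRep ΔH (fundRep hl hl' hm 1) (fundRep hl hl' hm 0) x).submatrix (Equiv.prodComm _ _)
          (Equiv.prodComm _ _) := by
  induction x using ULink.induction with
  | algebraMap r =>
    have h : (1 : Matrix (Fin 2 × Fin 2) (Fin 2 × Fin 2) ℂ).submatrix Prod.swap Prod.swap = 1 :=
      Matrix.submatrix_one_equiv (Equiv.prodComm _ _)
    simp [Algebra.algebraMap_eq_smul_one, Matrix.submatrix_smul, h]
  | gen n => rw [kronRep_ugen _ _ _ hΔ, kronRep_ugen _ _ _ hΔ, genKron_link hl hl' hm]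
  | mul x y hx hy =>
    rw [map_mul, map_mul, Matrix.mul_assoc, hy, ← Matrix.mul_assoc, hx, Matrix.mul_assoc,
      Matrix.submatrix_mul_equiv]
  | add x y hx hy =>
    rw [map_add, map_add, Matrix.add_mul, hx, hy, ← Matrix.mul_add]
    rfl

end relations

/-- A pair of matrices over `C` satisfying the invariance relations for `invVec` and the linking
relations satisfies the defining relations of `A_{q,q',ℓ}`. -/
theorem alinkRel_of_matrix {l l' m : ℂ} (hl : l ≠ 0) (hl' : l' ≠ 0) (hm : m ≠ 0) {C : Type*}
    [Ring C] [Algebra ℂ C] (t : Fin 8 → C)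
    (hcol : ∀ s i j, t (matIdx s i 0) * t (matIdx s j 1) -
      ![(l ^ 2)⁻¹, l' ^ 2] s • (t (matIdx s i 1) * t (matIdx s j 0)) = invVec l l' s (i, j) • 1)
    (hrow : ∀ s i j, t (matIdx s 0 i) * t (matIdx s 1 j) -
      ![(l ^ 2)⁻¹, l' ^ 2] s • (t (matIdx s 1 i) * t (matIdx s 0 j)) = invVec l l' s (i, j) • 1)
    (hlink : ∀ i j k o, linkCoeff (m ^ 2) (k, o) • (t (matIdx 0 i k) * t (matIdx 1 j o)) =
      linkCoeff (m ^ 2) (i, j) • (t (matIdx 1 j o) * t (matIdx 0 i k)))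
    ⦃x y : FreeAlgebra ℂ (Fin 8)⦄ (h : ALinkRel (l ^ 2) (l' ^ 2) (m ^ 2) x y) :
    FreeAlgebra.lift ℂ t x = FreeAlgebra.lift ℂ t y := by
  have c0 := hcol 0
  have c1 := hcol 1
  have r0 := hrow 0
  have r1 := hrow 1
  simp only [Fin.forall_fin_two, matIdx, invVec, linkCoeff, Fin.isValue, Matrix.cons_val_zero,
    Matrix.cons_val_one, Matrix.of_apply, zero_smul, one_smul, if_true, zero_ne_one, one_ne_zero,
    if_false, smul_right_inj (pow_ne_zero 2 hm)] at c0 c1 r0 r1 hlink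
  obtain ⟨⟨cab, cdet⟩, cdet', ccd⟩ := c0
  obtain ⟨⟨cab', cdet₁⟩, cdet₁', ccd'⟩ := c1
  obtain ⟨⟨rac, rdet⟩, -, rbd⟩ := r0
  obtain ⟨⟨rac', rdet₁⟩, -, rbd'⟩ := r1
  have bc : t 1 * t 2 = t 2 * t 1 := by
    linear_combination (norm := skip) (l ^ 2) • (rdet - cdet)
    match_scalars <;> field_simp <;> ring
  have bc' : t 5 * t 6 = t 6 * t 5 := by
    linear_combination (norm := skip) (l' ^ 2)⁻¹ • (rdet₁ - cdet₁)
    match_scalars <;> field_simp <;> ring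
  cases h <;> simp only [map_mul, map_smul, map_sub, map_one, FreeAlgebra.lift_ι_apply]
  case ab => exact sub_eq_zero.mp cab
  case ac => exact sub_eq_zero.mp rac
  case bd => exact sub_eq_zero.mp rbd
  case cd => exact sub_eq_zero.mp ccd
  case bc => exact bc
  case ad =>
    linear_combination (norm := skip) cdet + (l ^ 2) • (cdet' + bc)
    match_scalars <;> field_simp <;> ring
  case ab' => exact sub_eq_zero.mp cab'
  case ac' => exact sub_eq_zero.mp rac'
  case bd' => exact sub_eq_zero.mp rbd'
  case cd' => exact sub_eq_zero.mp ccd'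
  case bc' => exact bc'
  case ad' =>
    linear_combination (norm := skip) cdet₁ + (l' ^ 2)⁻¹ • (cdet₁' + bc')
    match_scalars <;> field_simp <;> ring
  case det => exact cdet
  case det' => exact cdet₁
  all_goals grind

section pairing

variable {H A : Type*} [Ring H] [Algebra ℂ H] [Ring A] [Algebra ℂ A]

@[simp]
theorem pair2_tmul (B : H →ₗ[ℂ] Module.Dual ℂ A) (x y : H) (f g : A) :
    pair2 B (x ⊗ₜ y) (f ⊗ₜ g) = B x f * B y g := by
  simp [pair2]

theorem pair2_apply_tmul (B : H →ₗ[ℂ] Module.Dual ℂ A) (X : H ⊗[ℂ] H) (f g : A) :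
    pair2 B X (f ⊗ₜ g) = LinearMap.mul' ℂ ℂ (TensorProduct.map (B.flip f) (B.flip g) X) := by
  induction X using TensorProduct.induction_on with
  | zero => simp
  | tmul x y => simp
  | add X Y hX hY => simp only [map_add, LinearMap.add_apply, hX, hY]

/-- Pairing products in `A ⊗ A` with a pure tensor, when the pairing is multiplicative in its
second argument. -/
theorem pair2_tmul_mul (B : H →ₗ[ℂ] Module.Dual ℂ A) {ι κ : Type*} {I : Finset ι} {J : Finset κ}
    {x y : H} {x₁ x₂ : ι → H} {y₁ y₂ : κ → H}
    (hx : ∀ f g, B x (f * g) = ∑ i ∈ I, B (x₁ i) f * B (x₂ i) g)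
    (hy : ∀ f g, B y (f * g) = ∑ j ∈ J, B (y₁ j) f * B (y₂ j) g) (F G : A ⊗[ℂ] A) :
    pair2 B (x ⊗ₜ y) (F * G) = ∑ i ∈ I, ∑ j ∈ J,
      pair2 B (x₁ i ⊗ₜ y₁ j) F * pair2 B (x₂ i ⊗ₜ y₂ j) G := by
  induction F using TensorProduct.induction_on with
  | zero => simp
  | add F F' hF hF' => simp only [add_mul, map_add, hF, hF', Finset.sum_add_distrib]
  | tmul f f' =>
    induction G using TensorProduct.induction_on with
    | zero => simp
    | add G G' hG hG' => simp only [mul_add, map_add, hG, hG', Finset.sum_add_distrib]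
    | tmul g g' =>
      simp only [Algebra.TensorProduct.tmul_mul_tmul, pair2_tmul, hx, hy, Finset.sum_mul_sum]
      exact Finset.sum_congr rfl fun i _ => Finset.sum_congr rfl fun j _ => by ring

/-- If the pairing is multiplicative in its second argument, the elements `f` of `A` for which
`⟨xy, f⟩ = Σ⟨x, f₍₁₎⟩⟨y, f₍₂₎⟩` holds are closed under multiplication. -/
theorem map_mul_eq_pair2_mul {B : H →ₗ[ℂ] Module.Dual ℂ A} {ΔH : H →ₐ[ℂ] H ⊗[ℂ] H}
    {ΔA : A →ₐ[ℂ] A ⊗[ℂ] A}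
    (hB : ∀ (x : H) (f g : A), B x (f * g) = pair2 B (ΔH x) (f ⊗ₜ[ℂ] g)) {f g : A}
    (hf : ∀ x y, B (x * y) f = pair2 B (x ⊗ₜ y) (ΔA f))
    (hg : ∀ x y, B (x * y) g = pair2 B (x ⊗ₜ y) (ΔA g)) (x y : H) :
    B (x * y) (f * g) = pair2 B (x ⊗ₜ y) (ΔA (f * g)) := by
  obtain ⟨I, hI⟩ := TensorProduct.exists_finset (ΔH x)
  obtain ⟨J, hJ⟩ := TensorProduct.exists_finset (ΔH y)
  have hx : ∀ f g, B x (f * g) = ∑ i ∈ I, B i.1 f * B i.2 g := fun f g => by simp [hB, hI]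
  have hy : ∀ f g, B y (f * g) = ∑ i ∈ J, B i.1 f * B i.2 g := fun f g => by simp [hB, hJ]
  rw [map_mul ΔA, pair2_tmul_mul B hx hy, hB, map_mul, hI, hJ, Finset.sum_mul_sum]
  simp [hf, hg]

end pairing

theorem exists_matIdx (j : Fin 8) : ∃ s i k, matIdx s i k = j := by
  revert j
  decide

theorem comul_agen {q q' ℓ : ℂ} {ΔA : ALink q q' ℓ →ₐ[ℂ] (ALink q q' ℓ ⊗[ℂ] ALink q q' ℓ)}
    (hΔ : IsAComul q q' ℓ ΔA) (s i k : Fin 2) :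
    ΔA (agen q q' ℓ (matIdx s i k)) =
      ∑ n, agen q q' ℓ (matIdx s i n) ⊗ₜ[ℂ] agen q q' ℓ (matIdx s n k) := by
  obtain ⟨h0, h1, h2, h3, h4, h5, h6, h7⟩ := hΔ
  fin_cases s <;> fin_cases i <;> fin_cases k <;>
    simpa [matIdx] using by assumption

theorem counit_agen {q q' ℓ : ℂ} {εA : ALink q q' ℓ →ₐ[ℂ] ℂ} (hε : IsACounit q q' ℓ εA)
    (s i k : Fin 2) :
    εA (agen q q' ℓ (matIdx s i k)) = (1 : Matrix (Fin 2) (Fin 2) ℂ) i k := by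
  obtain ⟨h0, h1, h2, h3, h4, h5, h6, h7⟩ := hε
  fin_cases s <;> fin_cases i <;> fin_cases k <;>
    simpa [matIdx] using by assumption

section existence

variable {l l' m : ℂ}
  {ΔH : ULink (l ^ 2) (l' ^ 2) (m ^ 2) →ₐ[ℂ]
    (ULink (l ^ 2) (l' ^ 2) (m ^ 2) ⊗[ℂ] ULink (l ^ 2) (l' ^ 2) (m ^ 2))}
  {εH : ULink (l ^ 2) (l' ^ 2) (m ^ 2) →ₐ[ℂ] ℂ}

theorem exists_pairing_fundRep (hl : l ≠ 0) (hl' : l' ≠ 0) (hm : m ≠ 0)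
    (hΔ : IsUComul (l ^ 2) (l' ^ 2) (m ^ 2) ΔH)
    (hε : IsUCounit (l ^ 2) (l' ^ 2) (m ^ 2) εH) :
    ∃ B : ULink (l ^ 2) (l' ^ 2) (m ^ 2) →ₗ[ℂ] Module.Dual ℂ (ALink (l ^ 2) (l' ^ 2) (m ^ 2)),
      (∀ x f g, B x (f * g) = pair2 B (ΔH x) (f ⊗ₜ[ℂ] g)) ∧ (∀ x, B x 1 = εH x) ∧
      ∀ x s i k, B x (agen _ _ _ (matIdx s i k)) = fundRep hl hl' hm s x i k := by
  let _ := ulinkCoalgebra ΔH εH hΔ hε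
  let t (j : Fin 8) : WithConv (ULink (l ^ 2) (l' ^ 2) (m ^ 2) →ₗ[ℂ] ℂ) :=
    WithConv.toConv (coeffFun (fundRep hl hl' hm (![0, 0, 0, 0, 1, 1, 1, 1] j))
      (![0, 0, 1, 1, 0, 0, 1, 1] j) (![0, 1, 0, 1, 0, 1, 0, 1] j))
  have ht (s i k) : t (matIdx s i k) = WithConv.toConv (coeffFun (fundRep hl hl' hm s) i k) := by
    fin_cases s <;> fin_cases i <;> fin_cases k <;> rfl
  have htt (s i k s' j o x) : (t (matIdx s i k) * t (matIdx s' j o)).ofConv x =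
      kronRep ΔH (fundRep hl hl' hm s) (fundRep hl hl' hm s') x (i, j) (k, o) := by
    rw [ht, ht, kronRep_apply]
    rfl
  have h1 (x) : (1 : WithConv (ULink (l ^ 2) (l' ^ 2) (m ^ 2) →ₗ[ℂ] ℂ)).ofConv x = εH x := rfl
  have hrel := alinkRel_of_matrix hl hl' hm t
    (fun s i j => by
      ext x
      have h := congrFun (kronRep_mulVec_invVec hl hl' hm hΔ hε s x) (i, j)
      simp only [Matrix.mulVec, dotProduct, Fintype.sum_prod_type, Fin.sum_univ_two, ← htt,
        Pi.smul_apply, smul_eq_mul] at h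
      simp only [WithConv.ofConv_sub, WithConv.ofConv_smul, LinearMap.sub_apply,
        LinearMap.smul_apply, smul_eq_mul, h1, mul_comm _ (εH x), ← h]
      simp [invVec]
      ring)
    (fun s i j => by
      ext x
      have h := congrFun (invVec_vecMul_kronRep hl hl' hm hΔ hε s x) (i, j)
      simp only [Matrix.vecMul, dotProduct, Fintype.sum_prod_type, Fin.sum_univ_two, ← htt,
        Pi.smul_apply, smul_eq_mul] at h
      simp only [WithConv.ofConv_sub, WithConv.ofConv_smul, LinearMap.sub_apply,
        LinearMap.smul_apply, smul_eq_mul, h1, mul_comm _ (εH x), ← h]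
      simp [invVec]
      ring)
    (fun i j k o => by
      ext x
      have h := congrFun (congrFun (kronRep_link hl hl' hm hΔ x) (i, j)) (k, o)
      rw [Matrix.mul_diagonal, Matrix.diagonal_mul, Matrix.submatrix_apply] at h
      simp only [Equiv.prodComm_apply, Prod.swap_prod_mk, ← htt] at h
      simpa only [WithConv.ofConv_smul, LinearMap.smul_apply, smul_eq_mul, mul_comm] using h)
  let Φ := RingQuot.liftAlgHom ℂ ⟨FreeAlgebra.lift ℂ t, hrel⟩
  have hΦ (j) : Φ (agen _ _ _ j) = t j := by simp [Φ, agen]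
  refine ⟨LinearMap.flip ((WithConv.linearEquiv ℂ _).toLinearMap ∘ₗ Φ.toLinearMap), ?_, ?_, ?_⟩
  · intro x f g
    rw [pair2_apply_tmul]
    simp [LinearMap.convMul_def]
    rfl
  · intro x
    simp [h1]
  · intro x s i k
    simp [hΦ, ht]

theorem exists_dualPairing (hl : l ≠ 0) (hl' : l' ≠ 0) (hm : m ≠ 0)
    {ΔA : ALink (l ^ 2) (l' ^ 2) (m ^ 2) →ₐ[ℂ]
      (ALink (l ^ 2) (l' ^ 2) (m ^ 2) ⊗[ℂ] ALink (l ^ 2) (l' ^ 2) (m ^ 2))}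
    {εA : ALink (l ^ 2) (l' ^ 2) (m ^ 2) →ₐ[ℂ] ℂ}
    (hΔ : IsUComul (l ^ 2) (l' ^ 2) (m ^ 2) ΔH) (hε : IsUCounit (l ^ 2) (l' ^ 2) (m ^ 2) εH)
    (hΔA : IsAComul (l ^ 2) (l' ^ 2) (m ^ 2) ΔA) (hεA : IsACounit (l ^ 2) (l' ^ 2) (m ^ 2) εA) :
    ∃ B : ULink (l ^ 2) (l' ^ 2) (m ^ 2) →ₗ[ℂ] Module.Dual ℂ (ALink (l ^ 2) (l' ^ 2) (m ^ 2)),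
      IsDualPairing B ΔH εH ΔA εA ∧
        ∀ i j, B (ugen _ _ _ i) (agen _ _ _ j) = pv l l' m i j := by
  obtain ⟨B, hmul, hone, hgen⟩ := exists_pairing_fundRep hl hl' hm hΔ hε
  have hB1 (f) : B 1 f = εA f := by
    induction f using ALink.induction with
    | algebraMap r => simp [Algebra.algebraMap_eq_smul_one, hone]
    | gen j =>
      obtain ⟨s, i, k, rfl⟩ := exists_matIdx j
      rw [hgen, counit_agen hεA, map_one]
    | mul f g hf hg => simp [hmul, Algebra.TensorProduct.one_def, hf, hg]
    | add f g hf hg => simp [hf, hg]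
  refine ⟨B, ⟨fun x y f => ?_, hmul, hB1, hone⟩, fun n j => ?_⟩
  · induction f using ALink.induction generalizing x y with
    | algebraMap r =>
      simp [Algebra.algebraMap_eq_smul_one, Algebra.TensorProduct.one_def, hone]
    | gen j =>
      obtain ⟨s, i, k, rfl⟩ := exists_matIdx j
      simp [comul_agen hΔA, hgen, Matrix.mul_apply]
    | mul f g hf hg => exact map_mul_eq_pair2_mul hmul hf hg x y
    | add f g hf hg => simp [hf, hg]
  · obtain ⟨s, i, k, rfl⟩ := exists_matIdx j
    rw [hgen, fundRep_ugen]
    rfl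

end existence

/-- A dual pairing is determined by its values on the generators. -/
theorem IsDualPairing.ext_gen {q q' ℓ : ℂ}
    {ΔH : ULink q q' ℓ →ₐ[ℂ] (ULink q q' ℓ ⊗[ℂ] ULink q q' ℓ)} {εH : ULink q q' ℓ →ₐ[ℂ] ℂ}
    {ΔA : ALink q q' ℓ →ₐ[ℂ] (ALink q q' ℓ ⊗[ℂ] ALink q q' ℓ)} {εA : ALink q q' ℓ →ₐ[ℂ] ℂ}
    (hΔA : IsAComul q q' ℓ ΔA)
    {B₁ B₂ : ULink q q' ℓ →ₗ[ℂ] Module.Dual ℂ (ALink q q' ℓ)}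
    (h₁ : IsDualPairing B₁ ΔH εH ΔA εA) (h₂ : IsDualPairing B₂ ΔH εH ΔA εA)
    (h : ∀ i j, B₁ (ugen q q' ℓ i) (agen q q' ℓ j) = B₂ (ugen q q' ℓ i) (agen q q' ℓ j)) :
    B₁ = B₂ := by
  obtain ⟨hx₁, hf₁, hε₁, hη₁⟩ := h₁
  obtain ⟨hx₂, hf₂, hε₂, hη₂⟩ := h₂
  suffices ∀ f, B₁.flip f = B₂.flip f by
    ext x f
    exact DFunLike.congr_fun (this f) x
  intro f
  induction f using ALink.induction with
  | algebraMap r =>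
    ext x
    simp [Algebra.algebraMap_eq_smul_one, hη₁, hη₂]
  | gen j =>
    ext x
    obtain ⟨s, i, k, rfl⟩ := exists_matIdx j
    induction x using ULink.induction generalizing i k with
    | algebraMap r => simp [Algebra.algebraMap_eq_smul_one, hε₁, hε₂]
    | gen n => exact h n _
    | mul x y hx hy =>
      simp only [LinearMap.flip_apply] at hx hy ⊢
      simp only [hx₁, hx₂, comul_agen hΔA, map_sum, pair2_tmul, hx, hy]
    | add x y hx hy => simp only [map_add, hx, hy]
  | mul f g hf hg =>
    ext x
    simp only [LinearMap.flip_apply, hf₁, hf₂, pair2_apply_tmul, hf, hg]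
  | add f g hf hg => simp only [map_add, hf, hg]

section antipode

/-- The antipode of `U_{q,q'}^ℓ` is an anti-homomorphism of coalgebras. -/
theorem comul_antipode {q q' ℓ : ℂ} {ΔH : ULink q q' ℓ →ₐ[ℂ] (ULink q q' ℓ ⊗[ℂ] ULink q q' ℓ)}
    {SH : ULink q q' ℓ →ₗ[ℂ] ULink q q' ℓ} (hΔ : IsUComul q q' ℓ ΔH)
    (hS : IsUAntipode q q' ℓ SH) (x : ULink q q' ℓ) :
    ΔH (SH x) = TensorProduct.comm ℂ _ _ (TensorProduct.map SH SH (ΔH x)) := by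
  obtain ⟨hSmul, hS1, s0, s1, s6, s7, s2, s3, s4, s5, s8, s9, s10, s11⟩ := hS
  have hmul (X Y : ULink q q' ℓ ⊗[ℂ] ULink q q' ℓ) :
      TensorProduct.comm ℂ _ _ (TensorProduct.map SH SH (X * Y)) =
        TensorProduct.comm ℂ _ _ (TensorProduct.map SH SH Y) *
          TensorProduct.comm ℂ _ _ (TensorProduct.map SH SH X) := by
    induction X using TensorProduct.induction_on with
    | zero => simp
    | add X X' hX hX' => simp only [add_mul, mul_add, map_add, hX, hX']
    | tmul a b =>
      induction Y using TensorProduct.induction_on with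
      | zero => simp
      | add Y Y' hY hY' => simp only [add_mul, mul_add, map_add, hY, hY']
      | tmul c d => simp [hSmul]
  induction x using ULink.induction with
  | algebraMap r =>
    simp [Algebra.algebraMap_eq_smul_one, hS1, Algebra.TensorProduct.one_def]
  | gen n =>
    obtain ⟨h0, h1, h6, h7, hg⟩ := hΔ
    revert n
    refine forall_ugen_index ?_ ?_ ?_ ?_ fun i hi => ?_
    · simp only [s0, h0, map_add, map_smul, TensorProduct.map_tmul, TensorProduct.comm_tmul,
        hSmul, s2, s3, s10, s11, ugen_commute (i := 2) (j := 10) (by decide) (by decide),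
        ugen_commute (i := 3) (j := 11) (by decide) (by decide), smul_add,
        ← TensorProduct.smul_tmul', TensorProduct.tmul_smul, add_comm]
    · simp only [s1, h1, map_add, map_smul, TensorProduct.map_tmul, TensorProduct.comm_tmul,
        hSmul, s2, s3, s10, s11, ugen_commute (i := 2) (j := 11) (by decide) (by decide),
        ugen_commute (i := 3) (j := 10) (by decide) (by decide), smul_add,
        ← TensorProduct.smul_tmul', TensorProduct.tmul_smul, add_comm]
    · simp only [s6, h6, map_add, map_smul, TensorProduct.map_tmul, TensorProduct.comm_tmul,
        hSmul, s8, s9, s4, s5, ugen_commute (i := 8) (j := 5) (by decide) (by decide),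
        ugen_commute (i := 9) (j := 4) (by decide) (by decide), smul_add,
        ← TensorProduct.smul_tmul', TensorProduct.tmul_smul, add_comm]
    · simp only [s7, h7, map_add, map_smul, TensorProduct.map_tmul, TensorProduct.comm_tmul,
        hSmul, s8, s9, s4, s5, ugen_commute (i := 8) (j := 4) (by decide) (by decide),
        ugen_commute (i := 9) (j := 5) (by decide) (by decide), smul_add,
        ← TensorProduct.smul_tmul', TensorProduct.tmul_smul, add_comm]
    · revert i
      simp only [glSet, Finset.mem_insert, Finset.mem_singleton, forall_eq_or_imp,
        forall_eq] at hg ⊢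
      obtain ⟨h2, h3, h4, h5, h8, h9, h10, h11⟩ := hg
      simp [s2, s3, s4, s5, s8, s9, s10, s11, h2, h3, h4, h5, h8, h9, h10, h11]
  | mul x y hx hy => rw [hSmul, map_mul, map_mul, hmul, hx, hy]
  | add x y hx hy => simp only [map_add, hx, hy]

theorem counit_antipode {q q' ℓ : ℂ} {εH : ULink q q' ℓ →ₐ[ℂ] ℂ}
    {SH : ULink q q' ℓ →ₗ[ℂ] ULink q q' ℓ} (hε : IsUCounit q q' ℓ εH)
    (hS : IsUAntipode q q' ℓ SH) (x : ULink q q' ℓ) : εH (SH x) = εH x := by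
  obtain ⟨hSmul, hS1, s0, s1, s6, s7, s2, s3, s4, s5, s8, s9, s10, s11⟩ := hS
  induction x using ULink.induction with
  | algebraMap r => simp [Algebra.algebraMap_eq_smul_one, hS1]
  | gen n =>
    obtain ⟨e0, e1, e6, e7, eg⟩ := hε
    simp only [glSet, Finset.mem_insert, Finset.mem_singleton, forall_eq_or_imp, forall_eq] at eg
    fin_cases n <;> simp [s0, s1, s2, s3, s4, s5, s6, s7, s8, s9, s10, s11, e0, e1, e6, e7, eg]
  | mul x y hx hy => rw [hSmul, map_mul, map_mul, hx, hy, mul_comm]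
  | add x y hx hy => simp only [map_add, hx, hy]

/-- The antipode of `A_{q,q',ℓ}` is an anti-homomorphism of coalgebras on the generators. -/
theorem comul_antipode_agen {q q' ℓ : ℂ} (hq : q ≠ 0) (hq' : q' ≠ 0)
    {ΔA : ALink q q' ℓ →ₐ[ℂ] (ALink q q' ℓ ⊗[ℂ] ALink q q' ℓ)}
    {SA : ALink q q' ℓ →ₗ[ℂ] ALink q q' ℓ} (hΔ : IsAComul q q' ℓ ΔA)
    (hS : IsAAntipode q q' ℓ SA) (s i k : Fin 2) :
    ΔA (SA (agen q q' ℓ (matIdx s i k))) = ∑ n,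
      SA (agen q q' ℓ (matIdx s n k)) ⊗ₜ[ℂ] SA (agen q q' ℓ (matIdx s i n)) := by
  obtain ⟨-, -, s0, s1, s2, s3, s4, s5, s6, s7⟩ := hS
  obtain ⟨h0, h1, h2, h3, h4, h5, h6, h7⟩ := hΔ
  fin_cases s <;> fin_cases i <;> fin_cases k <;>
    simp [matIdx, s0, s1, s2, s3, s4, s5, s6, s7, h0, h1, h2, h3, h4, h5, h6, h7, -neg_smul,
      ← TensorProduct.smul_tmul', TensorProduct.tmul_smul, smul_smul, hq, hq', add_comm]

theorem counit_antipode_agen {q q' ℓ : ℂ} {εA : ALink q q' ℓ →ₐ[ℂ] ℂ}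
    {SA : ALink q q' ℓ →ₗ[ℂ] ALink q q' ℓ} (hε : IsACounit q q' ℓ εA)
    (hS : IsAAntipode q q' ℓ SA) (j : Fin 8) :
    εA (SA (agen q q' ℓ j)) = εA (agen q q' ℓ j) := by
  obtain ⟨-, -, s0, s1, s2, s3, s4, s5, s6, s7⟩ := hS
  obtain ⟨h0, h1, h2, h3, h4, h5, h6, h7⟩ := hε
  fin_cases j <;>
    simp [s0, s1, s2, s3, s4, s5, s6, s7, h0, h1, h2, h3, h4, h5, h6, h7]

theorem pairing_antipode_gen {l l' m : ℂ}
    {SH : ULink (l ^ 2) (l' ^ 2) (m ^ 2) →ₗ[ℂ] ULink (l ^ 2) (l' ^ 2) (m ^ 2)}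
    {SA : ALink (l ^ 2) (l' ^ 2) (m ^ 2) →ₗ[ℂ] ALink (l ^ 2) (l' ^ 2) (m ^ 2)}
    (hS : IsUAntipode (l ^ 2) (l' ^ 2) (m ^ 2) SH) (hSA : IsAAntipode (l ^ 2) (l' ^ 2) (m ^ 2) SA)
    {B : ULink (l ^ 2) (l' ^ 2) (m ^ 2) →ₗ[ℂ] Module.Dual ℂ (ALink (l ^ 2) (l' ^ 2) (m ^ 2))}
    (hB : ∀ i j, B (ugen _ _ _ i) (agen _ _ _ j) = pv l l' m i j) (n : Fin 12) (j : Fin 8) :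
    B (SH (ugen _ _ _ n)) (agen _ _ _ j) = B (ugen _ _ _ n) (SA (agen _ _ _ j)) := by
  obtain ⟨-, -, s0, s1, s6, s7, s2, s3, s4, s5, s8, s9, s10, s11⟩ := hS
  obtain ⟨-, -, t0, t1, t2, t3, t4, t5, t6, t7⟩ := hSA
  fin_cases n <;> fin_cases j <;>
    simp [s0, s1, s2, s3, s4, s5, s6, s7, s8, s9, s10, s11, t0, t1, t2, t3, t4, t5, t6, t7, hB, pv]

/-- A dual pairing with the prescribed values on the generators intertwines the antipodes. -/
theorem IsDualPairing.antipode {l l' m : ℂ} (hl : l ≠ 0) (hl' : l' ≠ 0)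
    {ΔH : ULink (l ^ 2) (l' ^ 2) (m ^ 2) →ₐ[ℂ]
      (ULink (l ^ 2) (l' ^ 2) (m ^ 2) ⊗[ℂ] ULink (l ^ 2) (l' ^ 2) (m ^ 2))}
    {εH : ULink (l ^ 2) (l' ^ 2) (m ^ 2) →ₐ[ℂ] ℂ}
    {SH : ULink (l ^ 2) (l' ^ 2) (m ^ 2) →ₗ[ℂ] ULink (l ^ 2) (l' ^ 2) (m ^ 2)}
    {ΔA : ALink (l ^ 2) (l' ^ 2) (m ^ 2) →ₐ[ℂ]
      (ALink (l ^ 2) (l' ^ 2) (m ^ 2) ⊗[ℂ] ALink (l ^ 2) (l' ^ 2) (m ^ 2))}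
    {εA : ALink (l ^ 2) (l' ^ 2) (m ^ 2) →ₐ[ℂ] ℂ}
    {SA : ALink (l ^ 2) (l' ^ 2) (m ^ 2) →ₗ[ℂ] ALink (l ^ 2) (l' ^ 2) (m ^ 2)}
    (hΔ : IsUComul (l ^ 2) (l' ^ 2) (m ^ 2) ΔH) (hε : IsUCounit (l ^ 2) (l' ^ 2) (m ^ 2) εH)
    (hS : IsUAntipode (l ^ 2) (l' ^ 2) (m ^ 2) SH) (hΔA : IsAComul (l ^ 2) (l' ^ 2) (m ^ 2) ΔA)
    (hεA : IsACounit (l ^ 2) (l' ^ 2) (m ^ 2) εA) (hSA : IsAAntipode (l ^ 2) (l' ^ 2) (m ^ 2) SA)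
    {B : ULink (l ^ 2) (l' ^ 2) (m ^ 2) →ₗ[ℂ] Module.Dual ℂ (ALink (l ^ 2) (l' ^ 2) (m ^ 2))}
    (h : IsDualPairing B ΔH εH ΔA εA)
    (hB : ∀ i j, B (ugen _ _ _ i) (agen _ _ _ j) = pv l l' m i j)
    (x : ULink (l ^ 2) (l' ^ 2) (m ^ 2)) (f : ALink (l ^ 2) (l' ^ 2) (m ^ 2)) :
    B (SH x) f = B x (SA f) := by
  obtain ⟨hx, hf, hεB, hηB⟩ := h
  induction f using ALink.induction generalizing x with
  | algebraMap r =>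
    simp [Algebra.algebraMap_eq_smul_one, hSA.2.1, hηB, counit_antipode hε hS]
  | gen j =>
    obtain ⟨s, i, k, rfl⟩ := exists_matIdx j
    induction x using ULink.induction generalizing i k with
    | algebraMap r =>
      simp [Algebra.algebraMap_eq_smul_one, hS.2.1, hεB, counit_antipode_agen hεA hSA]
    | gen n => exact pairing_antipode_gen hS hSA hB n _
    | mul x y ihx ihy =>
      simp only [hS.1, hx, comul_agen hΔA,
        comul_antipode_agen (pow_ne_zero 2 hl) (pow_ne_zero 2 hl') hΔA hSA, map_sum, pair2_tmul,
        ihx, ihy, mul_comm]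
    | add x y ihx ihy => simp only [map_add, LinearMap.add_apply, ihx, ihy]
  | mul f g ihf ihg =>
    rw [hf, hSA.1, hf, comul_antipode hΔ hS]
    induction ΔH x using TensorProduct.induction_on with
    | zero => simp
    | tmul y z => simp [ihf, ihg, mul_comm]
    | add X Y hX hY => simp only [map_add, LinearMap.add_apply, hX, hY]
  | add f g ihf ihg => simp only [map_add, ihf, ihg]

end antipode

/-- For `λ, λ', m ∈ ℂ∖{0}` with `λ, λ' ∉ {1,−1}` and `q = λ²`, `q' = λ'²`,
`ℓ = m²`, there is a unique dual pairing of Hopf algebras between `U_{q,q'}^ℓ` and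
`A_{q,q',ℓ}` with the prescribed values on the generators; moreover it is compatible
with the antipodes: `⟨S(x), f⟩ = ⟨x, S(f)⟩`. -/
theorem linked_pairing_exists_unique (l l' m : ℂ)
    (hl : l ≠ 0 ∧ l ≠ 1 ∧ l ≠ -1) (hl' : l' ≠ 0 ∧ l' ≠ 1 ∧ l' ≠ -1) (hm : m ≠ 0) :
    let q := l ^ 2
    let q' := l' ^ 2
    let ℓ := m ^ 2
    ∀ (ΔH : ULink q q' ℓ →ₐ[ℂ] (ULink q q' ℓ ⊗[ℂ] ULink q q' ℓ))
      (εH : ULink q q' ℓ →ₐ[ℂ] ℂ) (SH : ULink q q' ℓ →ₗ[ℂ] ULink q q' ℓ)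
      (ΔA : ALink q q' ℓ →ₐ[ℂ] (ALink q q' ℓ ⊗[ℂ] ALink q q' ℓ))
      (εA : ALink q q' ℓ →ₐ[ℂ] ℂ) (SA : ALink q q' ℓ →ₗ[ℂ] ALink q q' ℓ),
      IsUComul q q' ℓ ΔH → IsUCounit q q' ℓ εH → IsUAntipode q q' ℓ SH →
      IsAComul q q' ℓ ΔA → IsACounit q q' ℓ εA → IsAAntipode q q' ℓ SA →
      (∃! B : ULink q q' ℓ →ₗ[ℂ] Module.Dual ℂ (ALink q q' ℓ),
        IsDualPairing B ΔH εH ΔA εA ∧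
        (∀ (i : Fin 12) (j : Fin 8),
          B (ugen q q' ℓ i) (agen q q' ℓ j) = pv l l' m i j)) ∧
      (∀ B : ULink q q' ℓ →ₗ[ℂ] Module.Dual ℂ (ALink q q' ℓ),
        IsDualPairing B ΔH εH ΔA εA ∧
        (∀ (i : Fin 12) (j : Fin 8),
          B (ugen q q' ℓ i) (agen q q' ℓ j) = pv l l' m i j) →
        ∀ (x : ULink q q' ℓ) (f : ALink q q' ℓ), B (SH x) f = B x (SA f)) := by
  intro q q' ℓ ΔH εH SH ΔA εA SA hΔ hε hS hΔA hεA hSA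
  obtain ⟨B, hB, hBgen⟩ := exists_dualPairing hl.1 hl'.1 hm hΔ hε hΔA hεA
  exact ⟨⟨B, ⟨hB, hBgen⟩, fun B' hB' => hB'.1.ext_gen hΔA hB fun i j => by
      rw [hB'.2, hBgen]⟩,
    fun B' hB' => hB'.1.antipode hl.1 hl'.1 hΔ hε hS hΔA hεA hSA hB'.2⟩
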